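/- For the family f_t(x,y) = x³ + y⁴ + xy² + t·x² with parameter t ∈ C, the local Milnor number of the origin as a critical point of f_t equals 5 when t = 1/4, equals 4 when t = 0, and equals 3 for all other t ∈ C. In each case the local Tyurina number at the origin equals the local Milnor number. -/

import Mathlib

open MvPolynomial

/-- Localizing at a maximal ideal `P` does not change the quotient by an ideal `K` whose radical
contains `P`. -/
theorem finrank_localization_quotient {k R : Type*} [Field k] [CommRing R] [Algebra k R]
    (P K J : Ideal R) [hP : P.IsMaximal] (hPK : P ≤ K.radical) (hJK : J ≤ K)
    (hKJ : ∀ g ∈ K, ∃ s ∉ P, s * g ∈ J) :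
    Module.finrank k (Localization.AtPrime P ⧸ J.map (algebraMap R (Localization.AtPrime P))) =
      Module.finrank k (R ⧸ K) := by
  have hunit : ∀ s ∉ P, ∃ u, 1 - s * u ∈ K := by
    intro s hs
    have htop : Ideal.span {s} ⊔ K = ⊤ := by
      by_contra hne
      obtain ⟨M, hM, hle⟩ := Ideal.exists_le_maximal _ hne
      have hPM : P ≤ M :=
        hPK.trans ((Ideal.IsPrime.radical_le_iff hM.isPrime).2 (le_sup_right.trans hle))
      have hPeq : P = M := hP.eq_of_le hM.ne_top hPM
      exact hs (hPeq ▸ hle (Ideal.mem_sup_left (Ideal.mem_span_singleton_self s)))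
    obtain ⟨a, ha, b, hb, hab⟩ := Submodule.mem_sup.1 ((Ideal.eq_top_iff_one _).1 htop)
    obtain ⟨u, rfl⟩ := Ideal.mem_span_singleton.1 ha
    exact ⟨u, by rwa [← hab, add_sub_cancel_left]⟩
  have hmap : ∀ g ∈ K, algebraMap R (Localization.AtPrime P) g ∈
      J.map (algebraMap R (Localization.AtPrime P)) := by
    intro g hg
    obtain ⟨s, hs, hsg⟩ := hKJ g hg
    have hu : IsUnit (algebraMap R (Localization.AtPrime P) s) :=
      IsLocalization.map_units (M := P.primeCompl) _ ⟨s, hs⟩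
    have := Ideal.mem_map_of_mem (algebraMap R (Localization.AtPrime P)) hsg
    rw [map_mul] at this
    exact (Ideal.unit_mul_mem_iff_mem _ hu).1 this
  let ψ : R →ₐ[k] Localization.AtPrime P ⧸ J.map (algebraMap R (Localization.AtPrime P)) :=
    (Ideal.Quotient.mkₐ k _).comp (IsScalarTower.toAlgHom k R (Localization.AtPrime P))
  have hψ : ∀ p, ψ p = Ideal.Quotient.mk _ (algebraMap R (Localization.AtPrime P) p) :=
    fun _ => rfl
  have hker : RingHom.ker ψ = K := by
    ext p
    rw [RingHom.mem_ker, hψ, Ideal.Quotient.eq_zero_iff_mem]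
    refine ⟨fun h => ?_, hmap p⟩
    rw [IsLocalization.algebraMap_mem_map_algebraMap_iff P.primeCompl] at h
    obtain ⟨s, hs, hsp⟩ := h
    obtain ⟨u, hu⟩ := hunit s hs
    have : p = (1 - s * u) * p + u * (s * p) := by ring
    rw [this]
    exact K.add_mem (K.mul_mem_right _ hu) (K.mul_mem_left _ (hJK hsp))
  have hsurj : Function.Surjective ψ := by
    intro z
    obtain ⟨z, rfl⟩ := Ideal.Quotient.mk_surjective z
    obtain ⟨r, s, rfl⟩ := IsLocalization.exists_mk'_eq P.primeCompl z
    obtain ⟨u, hu⟩ := hunit s s.2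
    refine ⟨r * u, ?_⟩
    rw [hψ, Ideal.Quotient.eq]
    have h := Ideal.mul_mem_left _ (-IsLocalization.mk' (Localization.AtPrime P) r s) (hmap _ hu)
    have hr := IsLocalization.mk'_spec (Localization.AtPrime P) r s
    convert h using 1
    simp only [map_mul, map_sub, map_one, ← hr]
    ring
  rw [← hker]
  exact (Ideal.quotientKerAlgEquivOfSurjective hsurj).toLinearEquiv.finrank_eq.symm

/-- The ideal `(yⁿ, x - g(y))` of `k[x, y]` has colength `n`. -/
theorem finrank_quotient_span_pow_sub {k : Type*} [Field k] (n : ℕ) (g : Polynomial k) :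
    Module.finrank k (MvPolynomial (Fin 2) k ⧸
      Ideal.span {(X 1 : MvPolynomial (Fin 2) k) ^ n, X 0 - Polynomial.aeval (X 1) g}) = n := by
  set K := Ideal.span {(X 1 : MvPolynomial (Fin 2) k) ^ n, X 0 - Polynomial.aeval (X 1) g}
    with hK
  let θ : MvPolynomial (Fin 2) k →ₐ[k] Polynomial k := aeval ![g, Polynomial.X]
  let ψ : MvPolynomial (Fin 2) k →ₐ[k]
      Polynomial k ⧸ Ideal.span {(Polynomial.X : Polynomial k) ^ n} :=
    (Ideal.Quotient.mkₐ k _).comp θ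
  have hψ : ∀ p, ψ p = Ideal.Quotient.mk _ (θ p) := fun _ => rfl
  have hθ : ∀ q : Polynomial k, θ (Polynomial.aeval (X 1) q) = q := by
    intro q
    rw [← Polynomial.aeval_algHom_apply]
    simp [θ]
  have h1 : (X 1 : MvPolynomial (Fin 2) k) ^ n ∈ K := Ideal.subset_span (by simp)
  have h0 : X 0 - Polynomial.aeval (X 1) g ∈ K := Ideal.subset_span (by simp)
  have hred : ∀ p, p - Polynomial.aeval (X 1) (θ p) ∈ K := by
    intro p
    induction p using MvPolynomial.induction_on with
    | C a => simp [θ, algebraMap_eq]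
    | add p q hp hq =>
      have := K.add_mem hp hq
      rw [map_add, map_add]
      convert this using 1
      ring
    | mul_X p i hp =>
      rw [map_mul, map_mul]
      fin_cases i
      · have := K.add_mem (K.mul_mem_right (X 0) hp)
          (K.mul_mem_left (Polynomial.aeval (X 1) (θ p)) h0)
        convert this using 1
        simp [θ]
        ring
      · convert K.mul_mem_right (X 1) hp using 1
        simp [θ]
        ring
  have hker : RingHom.ker ψ = K := by
    apply le_antisymm
    · intro p hp
      rw [RingHom.mem_ker, hψ, Ideal.Quotient.eq_zero_iff_mem, Ideal.mem_span_singleton] at hp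
      obtain ⟨q, hq⟩ := hp
      have h := hred p
      rw [hq, map_mul, map_pow, Polynomial.aeval_X] at h
      exact (Submodule.sub_mem_iff_left _ (K.mul_mem_right _ h1)).1 h
    · rw [hK, Ideal.span_le]
      rintro p (rfl | rfl)
      · simp only [SetLike.mem_coe, RingHom.mem_ker, hψ, Ideal.Quotient.eq_zero_iff_mem,
          Ideal.mem_span_singleton]
        simp [θ]
      · simp only [SetLike.mem_coe, RingHom.mem_ker, hψ, map_sub, hθ]
        simp [θ]
  have hsurj : Function.Surjective ψ := by
    intro z
    obtain ⟨q, rfl⟩ := Ideal.Quotient.mk_surjective z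
    exact ⟨Polynomial.aeval (X 1) q, by rw [hψ, hθ]⟩
  rw [← hker, (Ideal.quotientKerAlgEquivOfSurjective hsurj).toLinearEquiv.finrank_eq,
    finrank_quotient_span_eq_natDegree, Polynomial.natDegree_X_pow]

/-- The coordinates of a polynomial modulo `(3x² + y², xy, y³)` in the basis `1, x, y, x²`. -/
noncomputable def coordsD4 : MvPolynomial (Fin 2) ℂ →ₗ[ℂ] (Fin 4 → ℂ) :=
  LinearMap.pi ![lcoeff ℂ 0, lcoeff ℂ (Finsupp.single 0 1), lcoeff ℂ (Finsupp.single 1 1),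
    lcoeff ℂ (Finsupp.single 0 2) - (3 : ℂ) • lcoeff ℂ (Finsupp.single 1 2)]

theorem coordsD4_mul_X_zero (p : MvPolynomial (Fin 2) ℂ) :
    coordsD4 (p * X 0) = ![0, coordsD4 p 0, 0, coordsD4 p 1] := by
  have h : (Finsupp.single 0 2 : Fin 2 →₀ ℕ) - Finsupp.single 0 1 = Finsupp.single 0 1 := by
    rw [← Finsupp.single_tsub]
  ext i
  fin_cases i <;> simp [coordsD4, coeff_mul_X', h]

theorem coordsD4_mul_X_one (p : MvPolynomial (Fin 2) ℂ) :
    coordsD4 (p * X 1) = ![0, 0, coordsD4 p 0, -3 * coordsD4 p 2] := by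
  have h : (Finsupp.single 1 2 : Fin 2 →₀ ℕ) - Finsupp.single 1 1 = Finsupp.single 1 1 := by
    rw [← Finsupp.single_tsub]
  ext i
  fin_cases i <;> simp [coordsD4, coeff_mul_X', h]

theorem coordsD4_C (a : ℂ) : coordsD4 (C a) = ![a, 0, 0, 0] := by
  ext i
  fin_cases i <;> simp [coordsD4, coeff_C, eq_comm (a := (0 : Fin 2 →₀ ℕ))]

/-- The polynomial `3x² + y²` together with `xy` and `y³` spans an ideal of colength `4`. -/
theorem finrank_quotient_D4 :
    Module.finrank ℂ (MvPolynomial (Fin 2) ℂ ⧸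
      Ideal.span {(3 * X 0 ^ 2 + X 1 ^ 2 : MvPolynomial (Fin 2) ℂ), X 0 * X 1, X 1 ^ 3}) = 4 := by
  set K := Ideal.span {(3 * X 0 ^ 2 + X 1 ^ 2 : MvPolynomial (Fin 2) ℂ), X 0 * X 1, X 1 ^ 3}
    with hK
  let lift (c : Fin 4 → ℂ) : MvPolynomial (Fin 2) ℂ :=
    C (c 0) + C (c 1) * X 0 + C (c 2) * X 1 + C (c 3) * X 0 ^ 2
  have h1 : (3 * X 0 ^ 2 + X 1 ^ 2 : MvPolynomial (Fin 2) ℂ) ∈ K := Ideal.subset_span (by simp)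
  have h2 : (X 0 * X 1 : MvPolynomial (Fin 2) ℂ) ∈ K := Ideal.subset_span (by simp)
  have hC3 : (C 3 : MvPolynomial (Fin 2) ℂ) = 3 := map_ofNat C 3
  have hC : (C (1 / 3) : MvPolynomial (Fin 2) ℂ) * 3 = 1 := by
    rw [← hC3, ← C_mul]
    norm_num
  have h3 : (X 0 ^ 3 : MvPolynomial (Fin 2) ℂ) ∈ K := by
    convert K.sub_mem (K.mul_mem_left (C (1 / 3) * X 0) h1)
      (K.mul_mem_left (C (1 / 3) * X 1) h2) using 1
    linear_combination (-X 0 ^ 3) * hC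
  have hred : ∀ p, p - lift (coordsD4 p) ∈ K := by
    intro p
    induction p using MvPolynomial.induction_on with
    | C a => simp [lift, coordsD4_C]
    | add p q hp hq =>
      convert K.add_mem hp hq using 1
      simp only [lift, map_add, Pi.add_apply]
      ring
    | mul_X p i hp =>
      fin_cases i
      · convert K.add_mem (K.mul_mem_right (X 0) hp)
          (K.add_mem (K.mul_mem_left (C (coordsD4 p 2)) h2)
            (K.mul_mem_left (C (coordsD4 p 3)) h3)) using 1
        simp [lift, coordsD4_mul_X_zero]
        ring
      · convert K.add_mem (K.mul_mem_right (X 1) hp)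
          (K.add_mem (K.mul_mem_left (C (coordsD4 p 1) + C (coordsD4 p 3) * X 0) h2)
            (K.mul_mem_left (C (coordsD4 p 2)) h1)) using 1
        simp [lift, coordsD4_mul_X_one, hC3]
        ring
  have hker : LinearMap.ker coordsD4 = K.restrictScalars ℂ := by
    ext p
    rw [LinearMap.mem_ker, Submodule.restrictScalars_mem]
    refine ⟨fun h => by simpa [h, lift] using hred p, fun h => ?_⟩
    rw [hK, Ideal.mem_span_insert] at h
    obtain ⟨a, z, hz, rfl⟩ := h
    obtain ⟨b, c, rfl⟩ := Ideal.mem_span_pair.1 hz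
    have h : a * (3 * X 0 ^ 2 + X 1 ^ 2) + (b * (X 0 * X 1) + c * X 1 ^ 3) =
        (3 : ℂ) • (a * X 0 * X 0) + a * X 1 * X 1 + (b * X 0 * X 1 + c * X 1 * X 1 * X 1) := by
      rw [smul_eq_C_mul, hC3]
      ring
    rw [h]
    ext i
    fin_cases i <;> simp [coordsD4_mul_X_zero, coordsD4_mul_X_one]
  have hsurj : Function.Surjective coordsD4 := by
    intro c
    refine ⟨lift c, ?_⟩
    have hx : lift c = C (c 0) + C (c 1) * X 0 + C (c 2) * X 1 + C (c 3) * X 0 * X 0 := by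
      simp only [lift]
      ring
    rw [hx]
    ext i
    fin_cases i <;> simp [coordsD4_mul_X_zero, coordsD4_mul_X_one, coordsD4_C]
  have e := (Submodule.quotEquivOfEq _ _ hker).symm.trans
    (coordsD4.quotKerEquivOfSurjective hsurj)
  exact e.finrank_eq.trans (by simp)

theorem span_X_eq_ker :
    Ideal.span {(X 0 : MvPolynomial (Fin 2) ℂ), X 1} =
      RingHom.ker (constantCoeff : MvPolynomial (Fin 2) ℂ →+* ℂ) := by
  apply le_antisymm
  · rw [Ideal.span_le]
    rintro p (rfl | rfl) <;> simp
  · intro p hp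
    have h : ∀ q : MvPolynomial (Fin 2) ℂ, q - C (constantCoeff q) ∈
        Ideal.span {(X 0 : MvPolynomial (Fin 2) ℂ), X 1} := by
      intro q
      induction q using MvPolynomial.induction_on with
      | C a => simp
      | add p q hp hq =>
        convert Ideal.add_mem _ hp hq using 1
        simp only [map_add]
        ring
      | mul_X p i hp =>
        simp only [map_mul, constantCoeff_X, mul_zero, map_zero, sub_zero]
        refine Ideal.mul_mem_left _ _ (Ideal.subset_span ?_)
        fin_cases i <;> simp
    simpa [RingHom.mem_ker.1 hp] using h p

/-- The local Milnor and Tyurina numbers of `f` both equal the colength of an ideal that contains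
`f` and is locally generated by the partial derivatives of `f`. -/
theorem finrank_milnor_tyurina (P : Ideal (MvPolynomial (Fin 2) ℂ))
    (hP : P = Ideal.span {X 0, X 1}) [P.IsPrime] (f : MvPolynomial (Fin 2) ℂ)
    (G : Set (MvPolynomial (Fin 2) ℂ)) (N d : ℕ)
    (hd : Module.finrank ℂ (MvPolynomial (Fin 2) ℂ ⧸ Ideal.span G) = d)
    (hX0 : X 0 ^ N ∈ Ideal.span G) (hX1 : X 1 ^ N ∈ Ideal.span G)
    (hf : f ∈ Ideal.span G) (h0 : pderiv 0 f ∈ Ideal.span G) (h1 : pderiv 1 f ∈ Ideal.span G)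
    (hG : ∀ g ∈ G, ∃ s, constantCoeff s ≠ 0 ∧
      ∃ a b, s * g = a * pderiv 0 f + b * pderiv 1 f) :
    Module.finrank ℂ (Localization.AtPrime P ⧸ (Ideal.span {pderiv 0 f, pderiv 1 f}).map
        (algebraMap (MvPolynomial (Fin 2) ℂ) (Localization.AtPrime P))) = d ∧
    Module.finrank ℂ (Localization.AtPrime P ⧸ (Ideal.span {f, pderiv 0 f, pderiv 1 f}).map
        (algebraMap (MvPolynomial (Fin 2) ℂ) (Localization.AtPrime P))) = d := by
  rw [← hd]
  have hker := hP.trans span_X_eq_ker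
  have hmax : P.IsMaximal := by
    rw [hker]
    exact RingHom.ker_isMaximal_of_surjective _ fun a => ⟨C a, constantCoeff_C _ a⟩
  have hrad : P ≤ (Ideal.span G).radical := by
    rw [hP, Ideal.span_le]
    rintro p (rfl | rfl)
    exacts [⟨N, hX0⟩, ⟨N, hX1⟩]
  have hloc : ∀ g ∈ Ideal.span G, ∃ s ∉ P, s * g ∈ Ideal.span {pderiv 0 f, pderiv 1 f} := by
    intro g hg
    induction hg using Submodule.span_induction with
    | mem g hg =>
      obtain ⟨s, hs, a, b, hab⟩ := hG g hg
      exact ⟨s, by rwa [hker, RingHom.mem_ker], Ideal.mem_span_pair.2 ⟨a, b, hab.symm⟩⟩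
    | zero => exact ⟨1, P.primeCompl.one_mem, by simp⟩
    | add g h _ _ hg hh =>
      obtain ⟨s, hs, hsg⟩ := hg
      obtain ⟨u, hu, huh⟩ := hh
      refine ⟨s * u, P.primeCompl.mul_mem hs hu, ?_⟩
      convert Ideal.add_mem _ (Ideal.mul_mem_left _ u hsg) (Ideal.mul_mem_left _ s huh) using 1
      ring
    | smul a g _ hg =>
      obtain ⟨s, hs, hsg⟩ := hg
      refine ⟨s, hs, ?_⟩
      rw [smul_eq_mul, mul_left_comm]
      exact Ideal.mul_mem_left _ _ hsg
  constructor
  · refine finrank_localization_quotient P _ _ hrad ?_ hloc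
    rw [Ideal.span_le]
    rintro p (rfl | rfl) <;> assumption
  · refine finrank_localization_quotient P _ _ hrad ?_ fun g hg => ?_
    · rw [Ideal.span_le]
      rintro p (rfl | rfl | rfl) <;> assumption
    · obtain ⟨s, hs, hsg⟩ := hloc g hg
      exact ⟨s, hs, Ideal.span_mono (Set.subset_insert _ _) hsg⟩

theorem pderiv_zero_family (t : ℂ) :
    pderiv 0 (X 0 ^ 3 + X 1 ^ 4 + X 0 * X 1 ^ 2 + C t * X 0 ^ 2 : MvPolynomial (Fin 2) ℂ) =
      3 * X 0 ^ 2 + X 1 ^ 2 + 2 * C t * X 0 := by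
  simp
  ring

theorem pderiv_one_family (t : ℂ) :
    pderiv 1 (X 0 ^ 3 + X 1 ^ 4 + X 0 * X 1 ^ 2 + C t * X 0 ^ 2 : MvPolynomial (Fin 2) ℂ) =
      4 * X 1 ^ 3 + 2 * X 0 * X 1 := by
  simp
  ring

theorem two_mul_C_half : (2 : MvPolynomial (Fin 2) ℂ) * C (1 / 2) = 1 := by
  rw [show (2 : MvPolynomial (Fin 2) ℂ) = C 2 from (map_ofNat C 2).symm, ← C_mul]
  norm_num

/-- The case `t = 0`, a singularity of type `D₄`. -/
theorem milnor_tyurina_zero (P : Ideal (MvPolynomial (Fin 2) ℂ))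
    (hP : P = Ideal.span {X 0, X 1}) [P.IsPrime] (f : MvPolynomial (Fin 2) ℂ)
    (hf : f = X 0 ^ 3 + X 1 ^ 4 + X 0 * X 1 ^ 2 + C 0 * X 0 ^ 2) :
    Module.finrank ℂ (Localization.AtPrime P ⧸ (Ideal.span {pderiv 0 f, pderiv 1 f}).map
        (algebraMap (MvPolynomial (Fin 2) ℂ) (Localization.AtPrime P))) = 4 ∧
    Module.finrank ℂ (Localization.AtPrime P ⧸ (Ideal.span {f, pderiv 0 f, pderiv 1 f}).map
        (algebraMap (MvPolynomial (Fin 2) ℂ) (Localization.AtPrime P))) = 4 := by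
  have hd := two_mul_C_half
  have he : (3 : MvPolynomial (Fin 2) ℂ) * C (1 / 3) = 1 := by
    rw [show (3 : MvPolynomial (Fin 2) ℂ) = C 3 from (map_ofNat C 3).symm, ← C_mul]
    norm_num
  have hp0 : pderiv 0 f = 3 * X 0 ^ 2 + X 1 ^ 2 := by
    rw [hf, pderiv_zero_family, C_0]
    ring
  have hp1 : pderiv 1 f = 4 * X 1 ^ 3 + 2 * X 0 * X 1 := by rw [hf, pderiv_one_family]
  have hmem : ∀ a b c : MvPolynomial (Fin 2) ℂ,
      a * (3 * X 0 ^ 2 + X 1 ^ 2) + (b * (X 0 * X 1) + c * X 1 ^ 3) ∈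
        Ideal.span {(3 * X 0 ^ 2 + X 1 ^ 2 : MvPolynomial (Fin 2) ℂ), X 0 * X 1, X 1 ^ 3} :=
    fun a b c => Ideal.mem_span_insert.2 ⟨a, _, Ideal.mem_span_pair.2 ⟨b, c, rfl⟩, rfl⟩
  apply finrank_milnor_tyurina P hP f _ 3 4 finrank_quotient_D4
  · convert hmem (C (1 / 3) * X 0) (-C (1 / 3) * X 1) 0 using 1
    linear_combination (-X 0 ^ 3) * he
  · convert hmem 0 0 1 using 1
    ring
  · convert hmem (C (1 / 3) * X 0) (-C (1 / 3) * X 1 + X 1) (X 1) using 1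
    rw [hf, C_0]
    linear_combination (-X 0 ^ 3) * he
  · convert hmem 1 0 0 using 1
    rw [hp0]
    ring
  · convert hmem 0 2 4 using 1
    rw [hp1]
    ring
  · rw [hp0, hp1]
    rintro g (rfl | rfl | rfl)
    · exact ⟨1, by simp, 1, 0, by ring⟩
    · refine ⟨1 - 6 * X 0, by simp, -2 * X 1, C (1 / 2), ?_⟩
      linear_combination (-2 * X 1 ^ 3 - X 0 * X 1) * hd
    · refine ⟨1 - 6 * X 0, by simp, X 1, -3 * C (1 / 2) * X 0, ?_⟩
      linear_combination (6 * X 0 * X 1 ^ 3 + 3 * X 0 ^ 2 * X 1) * hd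

/-- The case `t ≠ 0, 1/4`, a singularity of type `A₃`. -/
theorem milnor_tyurina_generic (t : ℂ) (ht0 : t ≠ 0) (ht : t ≠ 1 / 4)
    (P : Ideal (MvPolynomial (Fin 2) ℂ))
    (hP : P = Ideal.span {X 0, X 1}) [P.IsPrime] (f : MvPolynomial (Fin 2) ℂ)
    (hf : f = X 0 ^ 3 + X 1 ^ 4 + X 0 * X 1 ^ 2 + C t * X 0 ^ 2) :
    Module.finrank ℂ (Localization.AtPrime P ⧸ (Ideal.span {pderiv 0 f, pderiv 1 f}).map
        (algebraMap (MvPolynomial (Fin 2) ℂ) (Localization.AtPrime P))) = 3 ∧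
    Module.finrank ℂ (Localization.AtPrime P ⧸ (Ideal.span {f, pderiv 0 f, pderiv 1 f}).map
        (algebraMap (MvPolynomial (Fin 2) ℂ) (Localization.AtPrime P))) = 3 := by
  obtain ⟨c, hc⟩ : ∃ c : ℂ, 2 * t * c = 1 := ⟨1 / (2 * t), by field_simp⟩
  have hC : (2 : MvPolynomial (Fin 2) ℂ) * C t * C c = 1 := by
    rw [show (2 : MvPolynomial (Fin 2) ℂ) = C 2 from (map_ofNat C 2).symm, ← C_mul, ← C_mul, hc,
      C_1]
  have hdim := finrank_quotient_span_pow_sub 3 (-(Polynomial.C c * Polynomial.X ^ 2))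
  have hg : (X 0 : MvPolynomial (Fin 2) ℂ) -
      Polynomial.aeval (X 1) (-(Polynomial.C c * Polynomial.X ^ 2)) = X 0 + C c * X 1 ^ 2 := by
    simp [algebraMap_eq]
  rw [hg] at hdim
  have hd := two_mul_C_half
  have hp0 : pderiv 0 f = 3 * X 0 ^ 2 + X 1 ^ 2 + 2 * C t * X 0 := by
    rw [hf, pderiv_zero_family]
  have hp1 : pderiv 1 f = 4 * X 1 ^ 3 + 2 * X 0 * X 1 := by rw [hf, pderiv_one_family]
  have hmem : ∀ a b : MvPolynomial (Fin 2) ℂ,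
      a * X 1 ^ 3 + b * (X 0 + C c * X 1 ^ 2) ∈
        Ideal.span {(X 1 : MvPolynomial (Fin 2) ℂ) ^ 3, X 0 + C c * X 1 ^ 2} :=
    fun a b => Ideal.mem_span_pair.2 ⟨a, b, rfl⟩
  have hs : 1 - 4 * t ≠ 0 := fun h => ht (by linear_combination (-1 / 4) * h)
  have hs0 : constantCoeff (1 - 4 * C t - 6 * X 0 : MvPolynomial (Fin 2) ℂ) ≠ 0 := by
    simpa [map_ofNat constantCoeff] using hs
  apply finrank_milnor_tyurina P hP f _ 3 3 hdim
  · convert hmem (-C c ^ 3 * X 1 ^ 3)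
      (X 0 ^ 2 - X 0 * C c * X 1 ^ 2 + C c ^ 2 * X 1 ^ 4) using 1
    ring
  · convert hmem 1 0 using 1
    ring
  · convert hmem (-C c ^ 3 * X 1 ^ 3 + X 1 - C c * X 1 + C t * C c ^ 2 * X 1)
      (X 0 ^ 2 - X 0 * C c * X 1 ^ 2 + C c ^ 2 * X 1 ^ 4 + X 1 ^ 2 +
        C t * (X 0 - C c * X 1 ^ 2)) using 1
    rw [hf]
    ring
  · convert hmem (3 * C c ^ 2 * X 1) (3 * (X 0 - C c * X 1 ^ 2) + 2 * C t) using 1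
    rw [hp0]
    linear_combination (-X 1 ^ 2) * hC
  · convert hmem (4 - 2 * C c) (2 * X 1) using 1
    rw [hp1]
    ring
  · rw [hp0, hp1]
    rintro g (rfl | rfl)
    · refine ⟨1 - 4 * C t - 6 * X 0, hs0, X 1, -(3 * C (1 / 2) * X 0 + C t), ?_⟩
      linear_combination (6 * X 0 * X 1 ^ 3 + 3 * X 0 ^ 2 * X 1) * hd
    · refine ⟨(1 - 4 * C t - 6 * X 0) * (2 * C t + 3 * X 0), ?_,
        C c * (2 * C t * (1 - 4 * C t - 6 * X 0) - 6 * X 1 ^ 2), C c * 3 * C (1 / 2) * X 1, ?_⟩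
      · rw [map_mul]
        exact mul_ne_zero hs0 (by simpa [map_ofNat constantCoeff] using ht0)
      · linear_combination (-(C c * 3 * X 1 * (2 * X 1 ^ 3 + X 0 * X 1))) * hd -
          (1 - 4 * C t - 6 * X 0) * (2 * C t + 3 * X 0) * X 0 * hC

/-- The case `t = 1/4`, a singularity of type `A₅`. -/
theorem milnor_tyurina_quarter (P : Ideal (MvPolynomial (Fin 2) ℂ))
    (hP : P = Ideal.span {X 0, X 1}) [P.IsPrime] (f : MvPolynomial (Fin 2) ℂ)
    (hf : f = X 0 ^ 3 + X 1 ^ 4 + X 0 * X 1 ^ 2 + C (1 / 4) * X 0 ^ 2) :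
    Module.finrank ℂ (Localization.AtPrime P ⧸ (Ideal.span {pderiv 0 f, pderiv 1 f}).map
        (algebraMap (MvPolynomial (Fin 2) ℂ) (Localization.AtPrime P))) = 5 ∧
    Module.finrank ℂ (Localization.AtPrime P ⧸ (Ideal.span {f, pderiv 0 f, pderiv 1 f}).map
        (algebraMap (MvPolynomial (Fin 2) ℂ) (Localization.AtPrime P))) = 5 := by
  have hC : (4 : MvPolynomial (Fin 2) ℂ) * C (1 / 4) = 1 := by
    rw [show (4 : MvPolynomial (Fin 2) ℂ) = C 4 from (map_ofNat C 4).symm, ← C_mul]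
    norm_num
  have hdim := finrank_quotient_span_pow_sub 5
    (-(2 * Polynomial.X ^ 2 + 24 * Polynomial.X ^ 4) : Polynomial ℂ)
  have hg : (X 0 : MvPolynomial (Fin 2) ℂ) - Polynomial.aeval (X 1)
      (-(2 * Polynomial.X ^ 2 + 24 * Polynomial.X ^ 4) : Polynomial ℂ) =
        X 0 + X 1 ^ 2 * (2 + 24 * X 1 ^ 2) := by
    simp only [map_neg, map_add, map_mul, map_pow, map_ofNat, Polynomial.aeval_X]
    ring
  rw [hg] at hdim
  have hp0 : pderiv 0 f = 3 * X 0 ^ 2 + X 1 ^ 2 + 2 * C (1 / 4) * X 0 := by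
    rw [hf, pderiv_zero_family]
  have hp1 : pderiv 1 f = 4 * X 1 ^ 3 + 2 * X 0 * X 1 := by rw [hf, pderiv_one_family]
  have hmem : ∀ a b : MvPolynomial (Fin 2) ℂ,
      a * X 1 ^ 5 + b * (X 0 + X 1 ^ 2 * (2 + 24 * X 1 ^ 2)) ∈
        Ideal.span {(X 1 : MvPolynomial (Fin 2) ℂ) ^ 5, X 0 + X 1 ^ 2 * (2 + 24 * X 1 ^ 2)} :=
    fun a b => Ideal.mem_span_pair.2 ⟨a, b, rfl⟩
  apply finrank_milnor_tyurina P hP f _ 5 5 hdim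
  · convert hmem (-X 0 ^ 2 * X 1 * (2 + 24 * X 1 ^ 2) ^ 3)
      (X 0 ^ 2 * (X 0 ^ 2 - X 0 * (X 1 ^ 2 * (2 + 24 * X 1 ^ 2)) +
        (X 1 ^ 2 * (2 + 24 * X 1 ^ 2)) ^ 2)) using 1
    ring
  · convert hmem 1 0 using 1
    ring
  · convert hmem (C (1 / 4) * (-4 * X 1 * (2 + 24 * X 1 ^ 2) ^ 3 + 576 * X 1 ^ 3))
      (C (1 / 4) * (4 * (X 0 ^ 2 - X 0 * (X 1 ^ 2 * (2 + 24 * X 1 ^ 2)) +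
        (X 1 ^ 2 * (2 + 24 * X 1 ^ 2)) ^ 2) + 4 * X 1 ^ 2 +
          (X 0 - X 1 ^ 2 * (2 + 24 * X 1 ^ 2)))) using 1
    rw [hf]
    linear_combination (-(X 0 ^ 3 + X 1 ^ 4 + X 0 * X 1 ^ 2)) * hC
  · convert hmem (2 * C (1 / 4) * (144 * X 1 * (4 + 24 * X 1 ^ 2)))
      (2 * C (1 / 4) * (6 * (X 0 - X 1 ^ 2 * (2 + 24 * X 1 ^ 2)) + 1)) using 1
    rw [hp0]
    linear_combination (-(3 * X 0 ^ 2 + X 1 ^ 2)) * hC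
  · convert hmem (-48) (2 * X 1) using 1
    rw [hp1]
    ring
  · rw [hp0, hp1]
    rintro g (rfl | rfl)
    · refine ⟨48, by simp [map_ofNat constantCoeff], 4 * X 1, 12 * X 1 ^ 2 - 6 * X 0 - 1, ?_⟩
      linear_combination (-2 * X 0 * X 1) * hC
    · refine ⟨1 + 6 * X 0, by simp, 2 - 24 * X 1 ^ 2, (36 * X 0 + 12) * X 1, ?_⟩
      linear_combination (-(1 - 12 * X 1 ^ 2) * X 0) * hC

/-- For the family f_t = x³ + y⁴ + xy² + t·x², the local Milnor number at the
origin is 5 for t = 1/4, 4 for t = 0 and 3 otherwise, and in each case the local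
Tyurina number equals the local Milnor number. -/
theorem local_milnor_tyurina_family (t : ℂ) (P : Ideal (MvPolynomial (Fin 2) ℂ))
    (hP : P = Ideal.span {X 0, X 1}) [P.IsPrime] :
    let ft : MvPolynomial (Fin 2) ℂ :=
      X 0 ^ 3 + X 1 ^ 4 + X 0 * X 1 ^ 2 + C t * X 0 ^ 2
    let J : Ideal (Localization.AtPrime P) :=
      (Ideal.span {pderiv 0 ft, pderiv 1 ft}).map
        (algebraMap (MvPolynomial (Fin 2) ℂ) (Localization.AtPrime P))
    let I : Ideal (Localization.AtPrime P) :=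
      (Ideal.span {ft, pderiv 0 ft, pderiv 1 ft}).map
        (algebraMap (MvPolynomial (Fin 2) ℂ) (Localization.AtPrime P))
    (t = 1/4 → Module.finrank ℂ (Localization.AtPrime P ⧸ J) = 5) ∧
    (t = 0 → Module.finrank ℂ (Localization.AtPrime P ⧸ J) = 4) ∧
    (t ≠ 1/4 → t ≠ 0 → Module.finrank ℂ (Localization.AtPrime P ⧸ J) = 3) ∧
    Module.finrank ℂ (Localization.AtPrime P ⧸ I)
      = Module.finrank ℂ (Localization.AtPrime P ⧸ J) := by
  intro ft J I
  by_cases h4 : t = 1 / 4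
  · subst h4
    obtain ⟨hJ, hI⟩ := milnor_tyurina_quarter P hP ft rfl
    exact ⟨fun _ => hJ, fun h => by norm_num at h, fun h => absurd rfl h, hI.trans hJ.symm⟩
  · by_cases h0 : t = 0
    · subst h0
      obtain ⟨hJ, hI⟩ := milnor_tyurina_zero P hP ft rfl
      exact ⟨fun h => absurd h h4, fun _ => hJ, fun _ h => absurd rfl h, hI.trans hJ.symm⟩
    · obtain ⟨hJ, hI⟩ := milnor_tyurina_generic t h0 h4 P hP ft rfl
      exact ⟨fun h => absurd h h4, fun h => absurd h h0, fun _ _ => hJ, hI.trans hJ.symm⟩
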